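/- For any tree T, the algebraic connectivity satisfies λ₂(L(T)) ≤ 2(1 − cos(π/(diam(T)+1))), where diam(T) is the diameter of T. Consequently λ₂(L(T)) → 0 as diam(T) → ∞. -/

import Mathlib

open SimpleGraph Matrix Real

/-- Rayleigh bound: the least nonzero Laplacian eigenvalue bounds the energy of mean-zero vectors. -/
theorem aux_rayleigh {n : ℕ} (G : SimpleGraph (Fin n)) [DecidableRel G.Adj]
    (hconn : G.Connected) (lam2 : ℝ)
    (hlb : ∀ μ : ℝ, μ ≠ 0 → ∀ w : Fin n → ℝ, w ≠ 0 →
      (G.lapMatrix ℝ).mulVec w = μ • w → lam2 ≤ μ)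
    (x : Fin n → ℝ) (hx : ∑ i, x i = 0) :
    lam2 * (x ⬝ᵥ x) ≤ x ⬝ᵥ (G.lapMatrix ℝ *ᵥ x) := by
  have hA : (G.lapMatrix ℝ).IsHermitian := G.isHermitian_lapMatrix ℝ
  set b := hA.eigenvectorBasis with hb
  let e : Fin n → Fin n → ℝ := fun k => ⇑(b k)
  have hpars : ∀ y z : Fin n → ℝ, ∑ k, (y ⬝ᵥ e k) * (e k ⬝ᵥ z) = y ⬝ᵥ z := by
    intro y z
    have h := b.sum_inner_mul_inner (WithLp.toLp 2 y) (WithLp.toLp 2 z)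
    simp only [EuclideanSpace.inner_eq_star_dotProduct, star_trivial] at h
    rw [dotProduct_comm y z, ← h]
    refine Finset.sum_congr rfl fun k _ => ?_
    rw [dotProduct_comm y, dotProduct_comm _ z]
  have he : ∀ k, G.lapMatrix ℝ *ᵥ e k = hA.eigenvalues k • e k := fun k =>
    hA.mulVec_eigenvectorBasis k
  have hsymm : (G.lapMatrix ℝ)ᵀ = G.lapMatrix ℝ := G.isSymm_lapMatrix ℝ
  have hL : ∀ k, e k ⬝ᵥ (G.lapMatrix ℝ *ᵥ x) = hA.eigenvalues k * (e k ⬝ᵥ x) := by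
    intro k
    rw [dotProduct_mulVec, ← mulVec_transpose, hsymm, he, smul_dotProduct, smul_eq_mul]
  rw [← hpars x x, ← hpars x (G.lapMatrix ℝ *ᵥ x), Finset.mul_sum]
  refine Finset.sum_le_sum fun k _ => ?_
  rw [hL, dotProduct_comm x (e k)]
  have hne : e k ≠ 0 := by
    intro h
    have h1 : b k ≠ 0 := b.orthonormal.ne_zero k
    apply h1
    ext i
    exact congrFun h i
  by_cases h0 : hA.eigenvalues k = 0
  · have h1 := he k
    rw [h0, zero_smul, lapMatrix_mulVec_eq_zero_iff_forall_reachable] at h1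
    have h2 : e k ⬝ᵥ x = 0 := by
      obtain ⟨i0⟩ := hconn.nonempty
      have : ∀ i, e k i = e k i0 := fun i => h1 i i0 (hconn.preconnected i i0)
      simp only [dotProduct, this]
      rw [← Finset.mul_sum, hx, mul_zero]
    rw [h2]; simp
  · have h1 := hlb _ h0 _ hne (he k)
    nlinarith [mul_self_nonneg (e k ⬝ᵥ x), mul_le_mul_of_nonneg_right h1 (mul_self_nonneg (e k ⬝ᵥ x))]

/-- Extension of a function along a path of a tree to the whole tree, with controlled energy. -/
theorem aux_extend {n : ℕ} (G : SimpleGraph (Fin n)) [DecidableRel G.Adj]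
    (hac : G.IsAcyclic) (d : ℕ) (v : ℕ → Fin n)
    (hinj : Set.InjOn v {i | i ≤ d}) (hadj : ∀ i < d, G.Adj (v i) (v (i + 1)))
    (g : ℕ → ℝ) :
    ∃ (f : Fin n → ℝ) (c : ℝ), (∀ i ≤ d, f (v i) = g i + c) ∧
      (∑ a : Fin n, ∑ b : Fin n, if G.Adj a b then (f a - f b) ^ 2 else 0) / 2 ≤
        ∑ i ∈ Finset.range d, (g (i + 1) - g i) ^ 2 := by
  classical
  let χ : ℕ → Fin n → ℝ := fun i a =>
    if (G.deleteEdges {s(v i, v (i + 1))}).Reachable (v (i + 1)) a then 1 else 0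
  have hχ : ∀ i a b, G.Adj a b → s(a, b) ≠ s(v i, v (i + 1)) → χ i a = χ i b := by
    intro i a b hab hne
    have h : (G.deleteEdges {s(v i, v (i + 1))}).Adj a b := by
      rw [deleteEdges_adj]
      exact ⟨hab, by simpa using hne⟩
    have : (G.deleteEdges {s(v i, v (i + 1))}).Reachable (v (i + 1)) a ↔
        (G.deleteEdges {s(v i, v (i + 1))}).Reachable (v (i + 1)) b :=
      ⟨fun h1 => h1.trans h.reachable, fun h1 => h1.trans h.reachable.symm⟩
    simp only [χ, this]
  have hχ1 : ∀ i, χ i (v (i + 1)) = 1 := fun i => if_pos (Reachable.refl _)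
  have hχ0 : ∀ i < d, χ i (v i) = 0 := by
    intro i hi
    refine if_neg fun h => ?_
    exact (isBridge_iff.1 (isAcyclic_iff_forall_isBridge.1 hac ((hadj i hi : _)))) h.symm
  have hedge : ∀ i < d, ∀ j < d, j ≠ i → s(v i, v (i + 1)) ≠ s(v j, v (j + 1)) := by
    intro i hi j hj hij h
    have hin : ∀ a ≤ d, ∀ b ≤ d, v a = v b → a = b := fun a ha b hb h => hinj ha hb h
    rw [Sym2.eq_iff] at h
    rcases h with ⟨h1, h2⟩ | ⟨h1, h2⟩
    · exact hij (hin _ hi.le _ hj.le h1).symm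
    · have := hin _ (by omega) _ (by omega) h1
      have := hin _ (by omega) _ (by omega) h2
      omega
  let f : Fin n → ℝ := fun a => ∑ i ∈ Finset.range d, (g (i + 1) - g i) * χ i a
  have hstep : ∀ i < d, f (v (i + 1)) - f (v i) = g (i + 1) - g i := by
    intro i hi
    simp only [f]
    rw [← Finset.sum_sub_distrib, Finset.sum_eq_single i]
    · rw [hχ1, hχ0 i hi]; ring
    · intro j hj hji
      rw [hχ j _ _ (hadj i hi) (hedge i hi j (Finset.mem_range.1 hj) hji), sub_self]
    · intro h; exact absurd (Finset.mem_range.2 hi) h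
  have hflat : ∀ a b, G.Adj a b → (∀ i < d, s(a, b) ≠ s(v i, v (i + 1))) → f a = f b := by
    intro a b hab h
    refine Finset.sum_congr rfl fun i hi => ?_
    rw [hχ i a b hab (h i (Finset.mem_range.1 hi))]
  refine ⟨f, f (v 0) - g 0, ?_, ?_⟩
  · intro i
    induction i with
    | zero => intro _; ring
    | succ k ih =>
      intro hk
      have h1 := ih (by omega)
      have h2 := hstep k (by omega)
      linarith
  · have hpt : ∀ a b, (if G.Adj a b then (f a - f b) ^ 2 else 0) ≤
        ∑ i ∈ Finset.range d, ((if a = v i then if b = v (i + 1) then (g (i + 1) - g i) ^ 2 else 0 else 0)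
          + (if a = v (i + 1) then if b = v i then (g (i + 1) - g i) ^ 2 else 0 else 0)) := by
      intro a b
      have hnn : ∀ i ∈ Finset.range d, 0 ≤
          ((if a = v i then if b = v (i + 1) then (g (i + 1) - g i) ^ 2 else 0 else 0)
          + (if a = v (i + 1) then if b = v i then (g (i + 1) - g i) ^ 2 else 0 else 0)) := by
        intro i _
        positivity
      split_ifs with hab
      · by_cases h : ∀ i < d, s(a, b) ≠ s(v i, v (i + 1))
        · rw [hflat a b hab h]
          simpa using Finset.sum_nonneg hnn
        · push Not at h
          obtain ⟨i, hi, h⟩ := h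
          refine le_trans ?_ (Finset.single_le_sum hnn (Finset.mem_range.2 hi))
          have h3 := hstep i hi
          rw [Sym2.eq_iff] at h
          rcases h with ⟨rfl, rfl⟩ | ⟨rfl, rfl⟩
          · rw [if_pos rfl, if_pos rfl, ← h3]
            have : (f (v i) - f (v (i+1))) ^ 2 = (f (v (i+1)) - f (v i)) ^ 2 := by ring
            rw [this]
            apply le_add_of_nonneg_right
            positivity
          · rw [if_pos (rfl : v (i + 1) = v (i + 1)), if_pos (rfl : v i = v i), ← h3]
            apply le_add_of_nonneg_left
            positivity
      · exact Finset.sum_nonneg hnn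
    have hsum := Finset.sum_le_sum fun a (_ : a ∈ Finset.univ) =>
      Finset.sum_le_sum fun b (_ : b ∈ Finset.univ) => hpt a b
    have heq : ∑ a : Fin n, ∑ b : Fin n, ∑ i ∈ Finset.range d,
        ((if a = v i then if b = v (i + 1) then (g (i + 1) - g i) ^ 2 else 0 else 0)
          + (if a = v (i + 1) then if b = v i then (g (i + 1) - g i) ^ 2 else 0 else 0))
        = ∑ i ∈ Finset.range d, 2 * (g (i + 1) - g i) ^ 2 := by
      simp_rw [Finset.sum_comm (s := Finset.univ) (t := Finset.range d)]
      refine Finset.sum_congr rfl fun i _ => ?_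
      simp only [Finset.sum_add_distrib, Finset.sum_ite_irrel, Finset.sum_const_zero,
        Finset.sum_ite_eq', Finset.mem_univ, if_true, Finset.sum_ite_eq]
      ring
    rw [heq, ← Finset.mul_sum] at hsum
    linarith

/-- The path eigenvector. -/
noncomputable def auxg (θ : ℝ) (i : ℕ) : ℝ := Real.cos (((i : ℝ) + 1 / 2) * θ)

theorem auxg_sum (d : ℕ) : ∑ i ∈ Finset.range (d + 1), auxg (π / (d + 1)) i = 0 := by
  set θ := π / ((d : ℝ) + 1) with hθ
  have hd : (0 : ℝ) < d + 1 := by positivity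
  have hpos : 0 < θ := div_pos pi_pos hd
  have hle : θ ≤ π := div_le_self pi_pos.le (by linarith [Nat.cast_nonneg (α := ℝ) d])
  have hs : Real.sin (θ / 2) ≠ 0 := (sin_pos_of_pos_of_lt_pi (by linarith) (by linarith [pi_pos])).ne'
  have h : ∀ k : ℕ, 2 * Real.sin (θ / 2) * ∑ i ∈ Finset.range k, auxg θ i = Real.sin (k * θ) := by
    intro k
    induction k with
    | zero => simp
    | succ k ih =>
      rw [Finset.sum_range_succ, mul_add, ih, auxg]
      have e1 : ((k + 1 : ℕ) : ℝ) * θ = ((k : ℝ) + 1 / 2) * θ + θ / 2 := by push_cast; ring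
      have e2 : (k : ℝ) * θ = ((k : ℝ) + 1 / 2) * θ - θ / 2 := by ring
      rw [e1, e2, Real.sin_add, Real.sin_sub]
      ring
  have h1 := h (d + 1)
  have e : ((d + 1 : ℕ) : ℝ) * θ = π := by push_cast; rw [hθ]; field_simp
  rw [e, Real.sin_pi] at h1
  rcases mul_eq_zero.1 h1 with h2 | h2
  · exact absurd h2 (mul_ne_zero two_ne_zero hs)
  · exact h2

theorem auxg_energy (d : ℕ) :
    ∑ i ∈ Finset.range d, (auxg (π / (d + 1)) (i + 1) - auxg (π / (d + 1)) i) ^ 2 =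
      2 * (1 - Real.cos (π / (d + 1))) * ∑ i ∈ Finset.range (d + 1), auxg (π / (d + 1)) i ^ 2 := by
  set θ := π / ((d : ℝ) + 1) with hθ
  have hd : (0 : ℝ) < d + 1 := by positivity
  have h : ∀ k : ℕ, ∑ i ∈ Finset.range k, (auxg θ (i + 1) - auxg θ i) ^ 2 =
      2 * (1 - Real.cos θ) * ∑ i ∈ Finset.range k, auxg θ i ^ 2 +
        auxg θ k * (auxg θ k - Real.cos (((k : ℝ) - 1 / 2) * θ)) := by
    intro k
    induction k with
    | zero =>
      have : ((0 : ℝ) - 1 / 2) * θ = -((0 + 1 / 2) * θ) := by ring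
      simp only [auxg, Finset.range_zero, Finset.sum_empty, Nat.cast_zero, this, Real.cos_neg]
      ring
    | succ k ih =>
      rw [Finset.sum_range_succ, ih, Finset.sum_range_succ]
      have e1 : auxg θ (k + 1) = Real.cos (((k : ℝ) + 1 / 2) * θ + θ) := by
        rw [auxg]; congr 1; push_cast; ring
      have e2 : ((k : ℝ) - 1 / 2) * θ = ((k : ℝ) + 1 / 2) * θ - θ := by ring
      have e3 : (((k + 1 : ℕ) : ℝ) - 1 / 2) * θ = ((k : ℝ) + 1 / 2) * θ := by push_cast; ring
      rw [e1, e2, e3, auxg, Real.cos_add, Real.cos_sub]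
      ring
  have h1 := h (d + 1)
  have e : auxg θ (d + 1) = auxg θ d := by
    have hp : ((d : ℝ) + 1) * θ = π := by rw [hθ]; field_simp
    have e1 : (((d + 1 : ℕ) : ℝ) + 1 / 2) * θ = π + θ / 2 := by push_cast; linarith
    have e2 : ((d : ℝ) + 1 / 2) * θ = π - θ / 2 := by linarith
    rw [auxg, auxg, e1, e2, Real.cos_add, Real.cos_sub]
    simp
  have ee : Real.cos ((((d + 1 : ℕ) : ℝ) - 1 / 2) * θ) = auxg θ d := by
    rw [auxg]; congr 1; push_cast; ring
  rw [Finset.sum_range_succ, ee, e] at h1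
  linarith

/-- for any tree `T`, the algebraic connectivity satisfies
`λ₂(L(T)) ≤ 2(1 − cos(π/(diam T + 1)))`. -/
theorem tree_lambda2_le_diameter_bound
    {n : ℕ} (G : SimpleGraph (Fin n)) [DecidableRel G.Adj]
    (htree : G.IsTree)
    (lam2 : ℝ)
    (hlam2 : IsLeast {μ : ℝ | μ ≠ 0 ∧ ∃ w : Fin n → ℝ, w ≠ 0 ∧
      (G.lapMatrix ℝ).mulVec w = μ • w} lam2) :
    lam2 ≤ 2 * (1 - Real.cos (Real.pi / (G.diam + 1))) := by
  have hconn := htree.connected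
  haveI := hconn.nonempty
  obtain ⟨⟨hl0, w, hw0, hw⟩, hlb⟩ := hlam2
  have hlb' : ∀ μ : ℝ, μ ≠ 0 → ∀ w : Fin n → ℝ, w ≠ 0 →
      (G.lapMatrix ℝ).mulVec w = μ • w → lam2 ≤ μ := fun μ h w hw hh => hlb ⟨h, w, hw, hh⟩
  -- the graph is nontrivial
  have hnt : Nontrivial (Fin n) := by
    by_contra hnt
    rw [not_nontrivial_iff_subsingleton] at hnt
    have : G.lapMatrix ℝ *ᵥ w = 0 :=
      (lapMatrix_mulVec_eq_zero_iff_forall_reachable G).2 fun i j _ => by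
        rw [Subsingleton.elim i j]
    rw [this] at hw
    rcases smul_eq_zero.1 hw.symm with h | h
    · exact hl0 h
    · exact hw0 h
  obtain ⟨u, v, huv⟩ := G.exists_dist_eq_diam
  have hd : 0 < G.diam := by
    refine Nat.pos_of_ne_zero (diam_ne_zero_of_ediam_ne_top ?_)
    exact connected_iff_ediam_ne_top.1 hconn
  obtain ⟨p, hp, hlen⟩ := hconn.exists_path_of_dist u v
  rw [huv] at hlen
  generalize G.diam = d at *
  set g := auxg (π / (d + 1)) with hg
  have hinj : Set.InjOn p.getVert {i | i ≤ d} := by rw [← hlen]; exact hp.getVert_injOn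
  obtain ⟨f, c, hf, hE⟩ := aux_extend G htree.isAcyclic d p.getVert hinj
    (fun i hi => p.adj_getVert_succ (by omega)) g
  -- mean-centred function
  let m : ℝ := (∑ i, f i) / n
  let x : Fin n → ℝ := fun i => f i - m
  have hn : (n : ℝ) ≠ 0 := by
    have : 0 < n := Fin.pos (Classical.arbitrary (Fin n))
    exact_mod_cast this.ne'
  have hx : ∑ i, x i = 0 := by
    simp only [x, m, Finset.sum_sub_distrib, Finset.sum_const, Finset.card_univ, Fintype.card_fin,
      nsmul_eq_mul]
    field_simp
    ring
  have hray := aux_rayleigh G hconn lam2 hlb' x hx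
  rw [← toLinearMap₂'_apply', lapMatrix_toLinearMap₂'] at hray
  simp only [x, sub_sub_sub_cancel_right] at hray
  have hnorm : ∑ i ∈ Finset.range (d + 1), g i ^ 2 ≤ x ⬝ᵥ x := by
    have h1 : ∑ i ∈ Finset.range (d + 1), x (p.getVert i) ^ 2 ≤ x ⬝ᵥ x := by
      classical
      rw [← Finset.sum_image (f := fun a => x a ^ 2) (g := p.getVert)]
      · simp only [dotProduct, ← sq]
        exact Finset.sum_le_sum_of_subset_of_nonneg (Finset.subset_univ _)
          fun _ _ _ => sq_nonneg _
      · intro a ha b hb hab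
        refine hinj ?_ ?_ hab
        · simp at ha ⊢; omega
        · simp at hb ⊢; omega
    refine le_trans ?_ h1
    have h2 : ∑ i ∈ Finset.range (d + 1), x (p.getVert i) ^ 2 =
        ∑ i ∈ Finset.range (d + 1), (g i ^ 2 + 2 * (c - m) * g i + (c - m) ^ 2) := by
      refine Finset.sum_congr rfl fun i hi => ?_
      simp only [x]
      rw [hf i (by simp at hi; omega)]
      ring
    rw [h2, Finset.sum_add_distrib, Finset.sum_add_distrib, ← Finset.mul_sum, hg, auxg_sum]
    simp only [mul_zero, add_zero, Finset.sum_const]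
    apply le_add_of_nonneg_right
    positivity
  rw [hg, auxg_energy, ← hg] at hE
  have hpos : 0 < ∑ i ∈ Finset.range (d + 1), g i ^ 2 := by
    refine Finset.sum_pos' (fun _ _ => sq_nonneg _) ⟨0, by simp, ?_⟩
    have hd1 : (1 : ℝ) ≤ d := by exact_mod_cast hd
    have : 0 < g 0 := by
      rw [hg, auxg]
      have h1 : 0 < π / ((d : ℝ) + 1) := by positivity
      have h2 : π / ((d : ℝ) + 1) < π := div_lt_self pi_pos (by linarith)
      apply Real.cos_pos_of_mem_Ioo
      constructor <;> push_cast <;> linarith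
    positivity
  set S := ∑ i ∈ Finset.range (d + 1), g i ^ 2
  by_contra hcon
  push Not at hcon
  have hK : 0 ≤ 2 * (1 - Real.cos (π / (d + 1))) := by
    linarith [Real.cos_le_one (π / ((d : ℝ) + 1))]
  have h1 : lam2 * S ≤ lam2 * (x ⬝ᵥ x) := mul_le_mul_of_nonneg_left hnorm (by linarith)
  have h2 : 2 * (1 - Real.cos (π / (d + 1))) * S < lam2 * S := mul_lt_mul_of_pos_right hcon hpos
  have h3 := hray.trans hE
  exact absurd (h2.trans_le (h1.trans h3)) (lt_irrefl _)
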